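/- Let R = [r] × [s] and x ∈ ℝ_{>0}^R. Then for all integers i, j with 0 ≤ i ≤ r − 1 and 0 ≤ j ≤ s − 1, the birational RSK map satisfies RSK(x)_{r−i, s−j} = ρ^{−min{i,j}}(φ⁻¹(x))_{r−i, s−j}. -/

import Mathlib

namespace Paper

/-- Membership in the rectangle poset `R = [1,r] × [1,s]` (coordinates in `ℤ`). -/
def inR (r s : ℕ) (p : ℤ × ℤ) : Prop :=
  1 ≤ p.1 ∧ p.1 ≤ (r : ℤ) ∧ 1 ≤ p.2 ∧ p.2 ≤ (s : ℤ)

instance (r s : ℕ) : DecidablePred (inR r s) := fun _ => by unfold inR; infer_instance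

/-- The cover relation in the product of two chains. -/
def CoverStep (p q : ℤ × ℤ) : Prop :=
  (q.1 = p.1 + 1 ∧ q.2 = p.2) ∨ (q.1 = p.1 ∧ q.2 = p.2 + 1)

/-- Upper covers of `p` inside the rectangle. -/
def upSet (r s : ℕ) (p : ℤ × ℤ) : Finset (ℤ × ℤ) :=
  ({(p.1 + 1, p.2), (p.1, p.2 + 1)} : Finset (ℤ × ℤ)).filter (inR r s)

/-- Lower covers of `p` inside the rectangle. -/
def downSet (r s : ℕ) (p : ℤ × ℤ) : Finset (ℤ × ℤ) :=
  ({(p.1 - 1, p.2), (p.1, p.2 - 1)} : Finset (ℤ × ℤ)).filter (inR r s)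

/-- Sum of the labels of the lower covers of `p` (empty sum = 1). -/
noncomputable def dsum (r s : ℕ) (x : ℤ × ℤ → ℝ) (p : ℤ × ℤ) : ℝ :=
  if (downSet r s p).Nonempty then ∑ q ∈ downSet r s p, x q else 1

/-- Parallel sum of the labels of the upper covers of `p` (empty parallel sum = 1). -/
noncomputable def usum (r s : ℕ) (x : ℤ × ℤ → ℝ) (p : ℤ × ℤ) : ℝ :=
  if (upSet r s p).Nonempty then (∑ q ∈ upSet r s p, (x q)⁻¹)⁻¹ else 1

/-- The birational toggle at `p`. -/
noncomputable def toggle (r s : ℕ) (p : ℤ × ℤ) (x : ℤ × ℤ → ℝ) : ℤ × ℤ → ℝ :=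
  fun q => if q = p then usum r s x p * dsum r s x p / x p else x q

/-- The elements of `[1,a] × [1,b]` listed from top to bottom
(descending lexicographic order, the reverse of a linear extension). -/
def rectList (a b : ℕ) : List (ℤ × ℤ) :=
  (List.range a).reverse.flatMap fun i =>
    (List.range b).reverse.map fun j => ((i : ℤ) + 1, (j : ℤ) + 1)

/-- Birational rowmotion on the rectangle: toggles from top to bottom. -/
noncomputable def rho (r s : ℕ) (x : ℤ × ℤ → ℝ) : ℤ × ℤ → ℝ :=
  (rectList r s).foldl (fun y p => toggle r s p y) x

/-- Inverse birational rowmotion: toggles from bottom to top. -/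
noncomputable def rhoInv (r s : ℕ) (x : ℤ × ℤ → ℝ) : ℤ × ℤ → ℝ :=
  (rectList r s).reverse.foldl (fun y p => toggle r s p y) x

/-- Integer powers of birational rowmotion. -/
noncomputable def rhoPow (r s : ℕ) (k : ℤ) (x : ℤ × ℤ → ℝ) : ℤ × ℤ → ℝ :=
  if 0 ≤ k then (rho r s)^[k.toNat] x else (rhoInv r s)^[(-k).toNat] x

/-- Saturated chains from `a` to `b`, as lists of successive cover steps. -/
def ChainList (a b : ℤ × ℤ) : Type :=
  {l : List (ℤ × ℤ) // l.Chain' CoverStep ∧ l.head? = some a ∧ l.getLast? = some b}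

/-- The inverse birational transfer map on the rectangle: `φ⁻¹(x)_p` is the total weight
of all saturated chains from the minimal element `(1,1)` to `p`. -/
noncomputable def phiInv (x : ℤ × ℤ → ℝ) : ℤ × ℤ → ℝ :=
  fun p => ∑ᶠ c : ChainList (1, 1) p, (c.1.map x).prod

/-- The birational transfer map `φ(x)_p = x_p / ∑_{q ⋖ p} x_q`. -/
noncomputable def phi (r s : ℕ) (x : ℤ × ℤ → ℝ) : ℤ × ℤ → ℝ :=
  fun p => x p / dsum r s x p

/-- A collection of `k` pairwise vertex-disjoint lattice paths in the interval
`[i₁,i₂] × [j₁,j₂]`, from `(i₁,j₁),…,(i₁,j₁+k-1)` to `(i₂,j₂-k+1),…,(i₂,j₂)`. -/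
structure RSys (i₁ i₂ j₁ j₂ : ℤ) (k : ℕ) where
  path : Fin k → List (ℤ × ℤ)
  chain : ∀ t, (path t).Chain' CoverStep
  mem : ∀ t, ∀ v ∈ path t, i₁ ≤ v.1 ∧ v.1 ≤ i₂ ∧ j₁ ≤ v.2 ∧ v.2 ≤ j₂
  first : ∀ t : Fin k, (path t).head? = some (i₁, j₁ + ((t : ℕ) : ℤ))
  final : ∀ t : Fin k, (path t).getLast? = some (i₂, j₂ - k + 1 + ((t : ℕ) : ℤ))
  disjoint : ∀ t t' : Fin k, t ≠ t' → ∀ v ∈ path t, v ∉ path t'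

/-- The weight of a collection of paths: the product of labels of all its elements. -/
noncomputable def RSysWeight (x : ℤ × ℤ → ℝ) {i₁ i₂ j₁ j₂ : ℤ} {k : ℕ}
    (L : RSys i₁ i₂ j₁ j₂ k) : ℝ :=
  ∏ t : Fin k, ((L.path t).map x).prod

/-- `w_I^{(k)}(x)`: total weight of all collections of `k` nonintersecting paths in the
interval `I = [i₁,i₂] × [j₁,j₂]` (with `w_I^{(0)} = 1`). -/
noncomputable def w (i₁ i₂ j₁ j₂ : ℤ) (k : ℤ) (x : ℤ × ℤ → ℝ) : ℝ :=
  if k ≤ 0 then 1 else ∑ᶠ L : RSys i₁ i₂ j₁ j₂ k.toNat, RSysWeight x L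

/-- `w_I(x)`: the product of all labels in the interval `I = [i₁,i₂] × [j₁,j₂]`. -/
noncomputable def wProd (i₁ i₂ j₁ j₂ : ℤ) (x : ℤ × ℤ → ℝ) : ℝ :=
  ∏ p ∈ Finset.Icc i₁ i₂ ×ˢ Finset.Icc j₁ j₂, x p

/-- The directed edges of the graph `𝒢_R` on vertex set `[1,r+1] × [1,s]`:
`(i,j) → (i+1,j)` for `(i,j) ∈ R`, and `(i,j) → (i+1,j-1)` when valid. -/
def GEdge (r s : ℕ) (p q : ℤ × ℤ) : Prop :=
  1 ≤ p.1 ∧ p.1 ≤ (r : ℤ) ∧ 1 ≤ p.2 ∧ p.2 ≤ (s : ℤ) ∧ q.1 = p.1 + 1 ∧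
    (q.2 = p.2 ∨ (q.2 = p.2 - 1 ∧ 2 ≤ p.2))

/-- The weight of an edge of `𝒢_R`: `x_p⁻¹` for vertical edges, `1` for diagonal ones. -/
noncomputable def edgeWt (x : ℤ × ℤ → ℝ) (p q : ℤ × ℤ) : ℝ :=
  if q.2 = p.2 then (x p)⁻¹ else 1

/-- The weight of a directed path in `𝒢_R`, given as its list of vertices. -/
noncomputable def listWt (x : ℤ × ℤ → ℝ) (l : List (ℤ × ℤ)) : ℝ :=
  ((l.zip l.tail).map fun e => edgeWt x e.1 e.2).prod

/-- The boundary vertex `P_t` of `𝒢_R`: `P_j = (1,j)` for `1 ≤ j ≤ s`, `P_{s+i} = (i+1,s)`. -/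
def Pvert (s : ℕ) (t : ℤ) : ℤ × ℤ := if t ≤ (s : ℤ) then (1, t) else (t - s + 1, (s : ℤ))

/-- The boundary vertex `Q_t` of `𝒢_R`: `Q_i = (i,1)` for `1 ≤ i ≤ r`, `Q_{r+j} = (r+1,j)`. -/
def Qvert (r : ℕ) (t : ℤ) : ℤ × ℤ := if t ≤ (r : ℤ) then (t, 1) else ((r : ℤ) + 1, t - r)

/-- A collection of `k` pairwise vertex-disjoint directed paths in `𝒢_R` from
`{P_i, …, P_{i+k-1}}` to `{Q_j, …, Q_{j+k-1}}`. -/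
structure GSys (r s : ℕ) (i j : ℤ) (k : ℕ) where
  perm : Equiv.Perm (Fin k)
  path : Fin k → List (ℤ × ℤ)
  chain : ∀ t, (path t).Chain' (GEdge r s)
  first : ∀ t : Fin k, (path t).head? = some (Pvert s (i + ((t : ℕ) : ℤ)))
  final : ∀ t : Fin k, (path t).getLast? = some (Qvert r (j + (((perm t) : ℕ) : ℤ)))
  disjoint : ∀ t t' : Fin k, t ≠ t' → ∀ v ∈ path t, v ∉ path t'

/-- The weight of a collection of paths in `𝒢_R`: the product of the weights of all
edges used. -/
noncomputable def GSysWeight (x : ℤ × ℤ → ℝ) {r s : ℕ} {i j : ℤ} {k : ℕ}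
    (L : GSys r s i j k) : ℝ :=
  ∏ t : Fin k, listWt x (L.path t)

/-- `W_{ij}^{(k)}(x)`: total weight of all collections of `k` nonintersecting paths in
`𝒢_R` from `{P_i,…,P_{i+k-1}}` to `{Q_j,…,Q_{j+k-1}}`; `W_{ij}^{(0)} = 1`, and `0` when an
out-of-range index occurs. -/
noncomputable def W (r s : ℕ) (x : ℤ × ℤ → ℝ) (i j k : ℤ) : ℝ :=
  if k < 0 then 0
  else if k = 0 then 1
  else if 1 ≤ i ∧ 1 ≤ j ∧ i + k - 1 ≤ (r : ℤ) + s ∧ j + k - 1 ≤ (r : ℤ) + s then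
    ∑ᶠ L : GSys r s i j k.toNat, GSysWeight x L
  else 0


/-- `ρ_{[1,a]×[1,b]}⁻¹`: the inverse of the composition of the toggles of `R = [r] × [s]`
at the elements of the interval `[1,a] × [1,b]` (toggles applied from bottom to top). -/
noncomputable def rhoIInv (r s a b : ℕ) (x : ℤ × ℤ → ℝ) : ℤ × ℤ → ℝ :=
  (rectList a b).reverse.foldl (fun y p => toggle r s p y) x

/-- Auxiliary iterate: `RSKaux r s t = ρ_{[r-t]×[s-t]}⁻¹ ∘ ⋯ ∘ ρ_{[r-1]×[s-1]}⁻¹`. -/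
noncomputable def RSKaux (r s : ℕ) : ℕ → (ℤ × ℤ → ℝ) → (ℤ × ℤ → ℝ)
  | 0 => fun x => x
  | t + 1 => fun x => rhoIInv r s (r - (t + 1)) (s - (t + 1)) (RSKaux r s t x)

/-- The birational RSK map on labelings of `R = [r] × [s]`: with `m = min{r,s} - 1`,
`RSK = ρ_{[r-m]×[s-m]}⁻¹ ∘ ⋯ ∘ ρ_{[r-2]×[s-2]}⁻¹ ∘ ρ_{[r-1]×[s-1]}⁻¹ ∘ φ⁻¹`. -/
noncomputable def RSK (r s : ℕ) (x : ℤ × ℤ → ℝ) : ℤ × ℤ → ℝ :=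
  RSKaux r s (min r s - 1) (phiInv x)

theorem usum_congr {r s : ℕ} {x y : ℤ × ℤ → ℝ} {p : ℤ × ℤ}
    (h : ∀ q ∈ upSet r s p, x q = y q) : usum r s x p = usum r s y p := by
  unfold usum
  rw [Finset.sum_congr rfl fun q hq => by rw [h q hq]]

theorem dsum_congr {r s : ℕ} {x y : ℤ × ℤ → ℝ} {p : ℤ × ℤ}
    (h : ∀ q ∈ downSet r s p, x q = y q) : dsum r s x p = dsum r s y p := by
  unfold dsum
  rw [Finset.sum_congr rfl h]

theorem foldl_toggle_of_notMem {r s : ℕ} {p : ℤ × ℤ} (L : List (ℤ × ℤ)) (hp : p ∉ L)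
    (x : ℤ × ℤ → ℝ) : L.foldl (fun y q => toggle r s q y) x p = x p := by
  induction L generalizing x with
  | nil => rfl
  | cons a L ih =>
    rw [List.mem_cons, not_or] at hp
    rw [List.foldl_cons, ih hp.2, toggle, if_neg hp.1]

/-- The strict lexicographic order on `ℤ × ℤ`. -/
def LexLT (p q : ℤ × ℤ) : Prop := p.1 < q.1 ∨ (p.1 = q.1 ∧ p.2 < q.2)

/-- Toggling once at each element of a lexicographically increasing list computes each new
label from the old labels above it and the new labels below it. -/
theorem foldl_toggle_of_mem {r s : ℕ} {p : ℤ × ℤ} (L : List (ℤ × ℤ)) (hL : L.Pairwise LexLT)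
    (hp : p ∈ L) (x : ℤ × ℤ → ℝ) :
    L.foldl (fun y q => toggle r s q y) x p =
      usum r s x p * dsum r s (L.foldl (fun y q => toggle r s q y) x) p / x p := by
  obtain ⟨L₁, L₂, rfl⟩ := List.append_of_mem hp
  rw [List.pairwise_append, List.pairwise_cons] at hL
  obtain ⟨-, ⟨h₂, -⟩, h₁⟩ := hL
  have before : ∀ q ∈ L₁, LexLT q p := fun q hq => h₁ q hq p (by simp)
  have self₁ : p ∉ L₁ := fun h => by have := before p h; unfold LexLT at this; omega
  have self₂ : p ∉ L₂ := fun h => by have := h₂ p h; unfold LexLT at this; omega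
  rw [List.foldl_append, List.foldl_cons, foldl_toggle_of_notMem L₂ self₂, toggle, if_pos rfl,
    foldl_toggle_of_notMem L₁ self₁]
  congr 2
  · refine usum_congr fun q hq => foldl_toggle_of_notMem L₁ (fun h => ?_) x
    have := before q h
    unfold LexLT at this
    simp only [upSet, Finset.mem_filter, Finset.mem_insert, Finset.mem_singleton] at hq
    rcases hq.1 with rfl | rfl <;> simp at this
  · refine dsum_congr fun q hq => ?_
    have hlt : LexLT q p := by
      unfold LexLT
      simp only [downSet, Finset.mem_filter, Finset.mem_insert, Finset.mem_singleton] at hq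
      rcases hq.1 with rfl | rfl <;> simp
    have hq₂ : q ∉ L₂ := fun h => by
      have := h₂ q h
      unfold LexLT at this hlt
      omega
    have hne : q ≠ p := by
      rintro rfl
      unfold LexLT at hlt
      omega
    rw [foldl_toggle_of_notMem L₂ hq₂, toggle, if_neg hne]

theorem rectList_eq (a b : ℕ) : rectList a b =
    (List.range a).reverse.flatMap fun i : ℕ =>
      (List.range b).reverse.map fun j : ℕ => ((i : ℤ) + 1, (j : ℤ) + 1) := by
  simp only [rectList, List.bind_eq_flatMap, List.pure_def,
    List.map_eq_flatMap, List.flatMap_assoc, List.flatMap_cons, List.flatMap_nil,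
    List.append_nil]

theorem mem_rectList {a b : ℕ} {p : ℤ × ℤ} : p ∈ rectList a b ↔ inR a b p := by
  obtain ⟨u, v⟩ := p
  simp only [rectList_eq, List.mem_flatMap, List.mem_reverse, List.mem_range, List.mem_map,
    Prod.mk.injEq, inR]
  constructor
  · rintro ⟨i, hi, j, hj, rfl, rfl⟩
    omega
  · intro h
    exact ⟨(u - 1).toNat, by omega, (v - 1).toNat, by omega, by omega, by omega⟩

theorem pairwise_rectList_reverse (a b : ℕ) : (rectList a b).reverse.Pairwise LexLT := by
  rw [List.pairwise_reverse, rectList_eq, List.pairwise_flatMap]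
  refine ⟨fun i _ => ?_, ?_⟩
  · rw [List.pairwise_map, List.pairwise_reverse]
    refine List.pairwise_lt_range.imp fun {j k} h => Or.inr ⟨rfl, ?_⟩
    simpa using h
  · rw [List.pairwise_reverse]
    refine List.pairwise_lt_range.imp fun {i k} h p hp q hq => Or.inl ?_
    simp only [List.mem_map, List.mem_reverse, List.mem_range] at hp hq
    obtain ⟨_, _, rfl⟩ := hp
    obtain ⟨_, _, rfl⟩ := hq
    simpa using h

theorem rhoIInv_of_not_inR {r s a b : ℕ} {p : ℤ × ℤ} (hp : ¬ inR a b p) (x : ℤ × ℤ → ℝ) :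
    rhoIInv r s a b x p = x p :=
  foldl_toggle_of_notMem _ (by rwa [List.mem_reverse, mem_rectList]) x

theorem rhoIInv_of_inR {r s a b : ℕ} {p : ℤ × ℤ} (hp : inR a b p) (x : ℤ × ℤ → ℝ) :
    rhoIInv r s a b x p = usum r s x p * dsum r s (rhoIInv r s a b x) p / x p :=
  foldl_toggle_of_mem _ (pairwise_rectList_reverse a b)
    (by rwa [List.mem_reverse, mem_rectList]) x

/-- On `[1,a] × [1,b]`, inverse rowmotion agrees with its restriction to that interval, and it
depends only on the labels of `[1,a+1] × [1,b+1]`. -/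
theorem rhoIInv_eq_rhoInv {r s a b : ℕ} (ha : a ≤ r) (hb : b ≤ s) {x y : ℤ × ℤ → ℝ}
    (hxy : ∀ q, inR r s q → inR (a + 1) (b + 1) q → x q = y q) (n : ℕ) (p : ℤ × ℤ)
    (hp : inR a b p) (hn : p.1 + p.2 = n) : rhoIInv r s a b x p = rhoInv r s y p := by
  induction n using Nat.strong_induction_on generalizing p with
  | _ n ih =>
    have hpR : inR r s p := by unfold inR at *; omega
    change _ = rhoIInv r s r s y p
    rw [rhoIInv_of_inR hp, rhoIInv_of_inR hpR]
    congr 1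
    · congr 1
      · refine usum_congr fun q hq => ?_
        simp only [upSet, Finset.mem_filter, Finset.mem_insert, Finset.mem_singleton] at hq
        refine hxy q hq.2 ?_
        unfold inR at *
        rcases hq.1 with rfl | rfl <;> dsimp only <;> omega
      · refine dsum_congr fun q hq => ?_
        simp only [downSet, Finset.mem_filter, Finset.mem_insert, Finset.mem_singleton] at hq
        have hq' : inR a b q ∧ q.1 + q.2 = ((n - 1 : ℕ) : ℤ) := by
          unfold inR at *
          rcases hq with ⟨rfl | rfl, hq⟩ <;> dsimp only at * <;> omega
        exact ih (n - 1) (by unfold inR at hp; omega) q hq'.1 hq'.2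
    · exact hxy p hpR (by unfold inR at *; omega)

theorem RSKaux_eq_iterate_rhoInv (r s : ℕ) (x : ℤ × ℤ → ℝ) (t i j : ℕ) (hi : i < r)
    (hj : j < s) :
    RSKaux r s t x ((r : ℤ) - i, (s : ℤ) - j) =
      (rhoInv r s)^[min t (min i j)] x ((r : ℤ) - i, (s : ℤ) - j) := by
  induction t generalizing i j with
  | zero => simp [RSKaux]
  | succ t ih =>
    change rhoIInv r s (r - (t + 1)) (s - (t + 1)) (RSKaux r s t x) _ = _
    by_cases h : t + 1 ≤ min i j
    · rw [min_eq_left h, Function.iterate_succ_apply']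
      refine rhoIInv_eq_rhoInv (Nat.sub_le _ _) (Nat.sub_le _ _) ?_ (r - i + (s - j)) _ ?_ ?_
      · rintro ⟨u, v⟩ hq hq'
        unfold inR at hq hq'
        dsimp only at hq hq'
        obtain ⟨k, hk⟩ : ∃ k : ℕ, u = (r : ℤ) - k := ⟨(r - u).toNat, by omega⟩
        obtain ⟨l, hl⟩ : ∃ l : ℕ, v = (s : ℤ) - l := ⟨(s - v).toNat, by omega⟩
        subst hk hl
        rw [ih k l (by omega) (by omega), min_eq_left (by omega)]
      · unfold inR
        dsimp only
        omega
      · dsimp only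
        omega
    · rw [rhoIInv_of_not_inR (by unfold inR; dsimp only; omega), ih i j hi hj,
        show min t (min i j) = min (t + 1) (min i j) by omega]

/-- **Proposition 5.2.** `RSK(x)_{r-i, s-j} = ρ^{-min{i,j}}(φ⁻¹(x))_{r-i, s-j}`. -/
theorem RSK_as_rowmotion (r s : ℕ) (hr : 1 ≤ r) (hs : 1 ≤ s) (x : ℤ × ℤ → ℝ)
    (hx : ∀ p, inR r s p → 0 < x p) (i j : ℕ) (hi : i ≤ r - 1) (hj : j ≤ s - 1) :
    RSK r s x ((r : ℤ) - i, (s : ℤ) - j)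
      = (rhoInv r s)^[min i j] (phiInv x) ((r : ℤ) - i, (s : ℤ) - j) := by
  unfold RSK
  rw [RSKaux_eq_iterate_rhoInv r s _ _ i j (by omega) (by omega), min_eq_right (by omega)]

end Paper
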